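/- For zero-dimensional G-systems (X_i,G) (i=1,…,r), P^a(f,G) = Q^a(G,f,π), where Q^a(G,f,π) is the limit of Q^a(G,f,𝒰^{(1)},…,𝒰^{(r)}) as the maximal diameter of the clopen partitions 𝒰^{(i)} tends to 0, the limit being taken over families of finite clopen partitions 𝒰^{(i)} of X_i satisfying π_{i−1}^{−1}(𝒰^{(i)}) ⪯ 𝒰^{(i−1)} for i = 2,…,r. -/

import Mathlib

open scoped BigOperators NNReal
open Filter

namespace WPP

variable (G : Type) [Group G]

/-- `B(F,K) = {g ∈ G : Kg ∩ F ≠ ∅ and Kg ∩ (G∖F) ≠ ∅}`. -/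
def folnerB (F K : Finset G) : Set G :=
  {g : G | (∃ k ∈ K, k * g ∈ F) ∧ ∃ k ∈ K, k * g ∉ F}

/-- A Følner sequence of `G`. -/
def IsFolner (F : ℕ → Finset G) : Prop :=
  (∀ n, (F n).Nonempty) ∧
    ∀ K : Finset G, K.Nonempty →
      Tendsto (fun n => ((folnerB G (F n) K).ncard : ℝ) / ((F n).card : ℝ)) atTop (nhds 0)

/-- A `G`-system: a compact metric space together with a continuous action of `G`
by homeomorphisms. -/
structure GSystem where
  carrier : Type
  [metric : MetricSpace carrier]
  [cpt : CompactSpace carrier]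
  act : G → carrier → carrier
  one_act : ∀ x, act 1 x = x
  mul_act : ∀ g h x, act (g * h) x = act g (act h x)
  cont_act : ∀ g, Continuous (act g)

attribute [instance] GSystem.metric GSystem.cpt

variable {G}

noncomputable instance (S : GSystem G) : MeasurableSpace S.carrier := borel S.carrier
instance (S : GSystem G) : BorelSpace S.carrier := ⟨rfl⟩

/-- A factor map between `G`-systems: a continuous equivariant surjection. -/
structure FactorMap (S T : GSystem G) where
  toFun : S.carrier → T.carrier
  cont : Continuous toFun
  surj : Function.Surjective toFun
  equiv : ∀ g x, toFun (S.act g x) = T.act g (toFun x)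

/-- The dynamical (Bowen) metric `d_F(x,y) = max_{g∈F} d(gx,gy)`. -/
noncomputable def dynDist (S : GSystem G) (F : Finset G) (x y : S.carrier) : ℝ :=
  ((F.sup fun g => nndist (S.act g x) (S.act g y) : ℝ≥0) : ℝ)

/-- `diam(U, d_F) < ε`. -/
def diamLT (S : GSystem G) (F : Finset G) (U : Set S.carrier) (ε : ℝ) : Prop :=
  ∀ x ∈ U, ∀ y ∈ U, dynDist S F x y < ε

/-- The Birkhoff-type sum `S_F f(x) = Σ_{g∈F} f(gx)`. -/
noncomputable def birk (S : GSystem G) (f : S.carrier → ℝ) (F : Finset G) (x : S.carrier) : ℝ :=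
  ∑ g ∈ F, f (S.act g x)

variable (X : ℕ → GSystem G) (π : ∀ i, FactorMap (X i) (X (i + 1)))

/-- The recursively defined weighted quantities `P^a_{i+1}(Ω, f, F, ε)` (0-indexed: `wP … i`
corresponds to the paper's `P^a_{i+1}`, and `a i` to the paper's `a_{i+1}`). -/
noncomputable def wP (a : ℕ → ℝ) (f : (X 0).carrier → ℝ) (F : Finset G) (ε : ℝ) :
    (i : ℕ) → Set (X i).carrier → ℝ
  | 0, Ω => sInf {s | ∃ (n : ℕ) (U : Fin n → Set (X 0).carrier),
      (∀ j, IsOpen (U j)) ∧ (Ω ⊆ ⋃ j, U j) ∧ (∀ j, diamLT (X 0) F (U j) ε) ∧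
      s = ∑ j, Real.exp (sSup (birk (X 0) f F '' U j))}
  | i + 1, Ω => sInf {s | ∃ (n : ℕ) (U : Fin n → Set (X (i + 1)).carrier),
      (∀ j, IsOpen (U j)) ∧ (Ω ⊆ ⋃ j, U j) ∧ (∀ j, diamLT (X (i + 1)) F (U j) ε) ∧
      s = ∑ j, (wP a f F ε i ((π i).toFun ⁻¹' U j)) ^ (a i)}

/-- `lim_n log P^a_r(X_r, f, F_n, ε) / |F_n|` (realized as a `limsup` in `EReal`; by the
Ornstein–Weiss lemma the limit exists, so this is the limit). -/
noncomputable def pressEps (r : ℕ) (a : ℕ → ℝ) (f : (X 0).carrier → ℝ)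
    (Fn : ℕ → Finset G) (ε : ℝ) : EReal :=
  limsup (fun n =>
    ((Real.log (wP X π a f (Fn n) ε (r - 1) Set.univ) / ((Fn n).card : ℝ) : ℝ) : EReal)) atTop

/-- The `a`-weighted topological pressure `P^a(f,G) = lim_{ε→0} P^a(X_r,f,ε)`; since
`P^a(X_r,f,ε)` is non-decreasing as `ε` decreases, the limit equals the supremum over `ε > 0`. -/
noncomputable def press (r : ℕ) (a : ℕ → ℝ) (f : (X 0).carrier → ℝ)
    (Fn : ℕ → Finset G) : EReal :=
  ⨆ (ε : ℝ) (_ : 0 < ε), pressEps X π r a f Fn ε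

/-- Entropy `H_μ(p)` of a countable partition given by the fibers of `p`. -/
noncomputable def Hpart {Y : Type} [MeasurableSpace Y] {ι : Type}
    (μ : MeasureTheory.Measure Y) (p : Y → ι) : ℝ :=
  ∑' i : ι, Real.negMulLog ((μ (p ⁻¹' {i})).toReal)

/-- `h_μ(p, G) = lim_n H_μ(p_{F_n})/|F_n|` (realized as a `limsup`, which equals the limit
since the limit exists). -/
noncomputable def hSeq (S : GSystem G) (Fn : ℕ → Finset G)
    (μ : MeasureTheory.Measure S.carrier) (p : S.carrier → ℕ) : ℝ :=
  limsup (fun n =>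
    Hpart μ (fun x => fun g : (Fn n : Finset G) => p (S.act (g : G) x)) / ((Fn n).card : ℝ)) atTop

/-- The measure-theoretic entropy `h_μ(X,G)`: supremum of `h_μ(α,G)` over all finite
measurable partitions (encoded as measurable maps to `ℕ` with finite range). -/
noncomputable def mEnt (S : GSystem G) (Fn : ℕ → Finset G)
    (μ : MeasureTheory.Measure S.carrier) : EReal :=
  ⨆ p : {p : S.carrier → ℕ // Measurable p ∧ (Set.range p).Finite},
    ((hSeq S Fn μ p.1 : ℝ) : EReal)

/-- `μ ∈ M^G(X)`: a `G`-invariant Borel probability measure. -/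
def IsInvProb (S : GSystem G) (μ : MeasureTheory.Measure S.carrier) : Prop :=
  MeasureTheory.IsProbabilityMeasure μ ∧ ∀ g : G, μ.map (S.act g) = μ

/-- `π^{(i)} = π_i ∘ ⋯ ∘ π_1 : X_1 → X_{i+1}` (0-indexed). -/
noncomputable def chainMap : (i : ℕ) → (X 0).carrier → (X i).carrier
  | 0 => id
  | i + 1 => (π i).toFun ∘ chainMap i

/-- The weights `w_1 = a_1⋯a_{r−1}`, `w_i = (1−a_{i−1})a_i⋯a_{r−1}`, `w_r = 1−a_{r−1}`
(0-indexed: `wt a r i` is the paper's `w_{i+1}`, `a j` the paper's `a_{j+1}`). -/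
noncomputable def wt (a : ℕ → ℝ) (r i : ℕ) : ℝ :=
  if i = 0 then ∏ j ∈ Finset.range (r - 1), a j
  else (1 - a (i - 1)) * ∏ j ∈ Finset.Ico i (r - 1), a j

/-- `Σ_{i=1}^r w_i h_{μ_i}(X_i,G) + w_1 ∫ f dμ`. -/
noncomputable def wSum (r : ℕ) (a : ℕ → ℝ) (Fn : ℕ → Finset G) (f : (X 0).carrier → ℝ)
    (μ : MeasureTheory.Measure (X 0).carrier) : EReal :=
  (∑ i ∈ Finset.range r, ((wt a r i : ℝ) : EReal) * mEnt (X i) Fn (μ.map (chainMap X π i)))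
    + (((wt a r 0) * ∫ x, f x ∂μ : ℝ) : EReal)

/-- `P^a_var(f,G) = sup_{μ ∈ M^G(X_1)} ( Σ w_i h_{μ_i}(X_i,G) + w_1 ∫ f dμ )`. -/
noncomputable def Pvar (r : ℕ) (a : ℕ → ℝ) (Fn : ℕ → Finset G)
    (f : (X 0).carrier → ℝ) : EReal :=
  ⨆ μ : {μ : MeasureTheory.Measure (X 0).carrier // IsInvProb (X 0) μ},
    wSum X π r a Fn f μ.1

end WPP

namespace WPP

open Filter

variable {G : Type} [Group G]

/-- A finite open cover of the whole space. -/
def IsFinOpenCover (S : GSystem G) (U : Finset (Set S.carrier)) : Prop :=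
  (∀ A ∈ U, IsOpen A) ∧ ⋃₀ (U : Set (Set S.carrier)) = Set.univ

/-- `𝒱 ⪰ 𝒰`: the family `𝒱` refines `𝒰` (every member of `𝒱` is contained in some
member of `𝒰`). -/
def Refines {Y : Type} (V U : Finset (Set Y)) : Prop :=
  ∀ A ∈ V, ∃ B ∈ U, A ⊆ B

open Classical in
/-- The dynamical refinement `𝒰_F = ⋁_{g∈F} g⁻¹𝒰`. -/
noncomputable def coverJoin (S : GSystem G) (U : Finset (Set S.carrier)) (F : Finset G)
    [DecidableEq G] : Finset (Set S.carrier) :=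
  (F.pi fun _ => U).image fun c => ⋂ g, ⋂ (h : g ∈ F), S.act g ⁻¹' (c g h)

/-- A finite measurable partition of the whole space (as a finite family of sets). -/
def IsMPartition {Y : Type} [MeasurableSpace Y] (α : Finset (Set Y)) : Prop :=
  (∀ A ∈ α, MeasurableSet A) ∧ (⋃₀ (α : Set (Set Y)) = Set.univ) ∧
    ∀ A ∈ α, ∀ B ∈ α, A ≠ B → A ∩ B = ∅

/-- `H_μ(α) = −Σ_{A∈α} μ(A) log μ(A)`. -/
noncomputable def Hfin {Y : Type} [MeasurableSpace Y] (μ : MeasureTheory.Measure Y)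
    (α : Finset (Set Y)) : ℝ :=
  ∑ A ∈ α, Real.negMulLog ((μ A).toReal)

/-- `H_μ(𝒰) = inf{H_μ(α) : α a finite measurable partition refining 𝒰}`. -/
noncomputable def covEnt {Y : Type} [MeasurableSpace Y] (μ : MeasureTheory.Measure Y)
    (U : Finset (Set Y)) : ℝ :=
  sInf {h | ∃ α : Finset (Set Y), IsMPartition α ∧ Refines α U ∧ h = Hfin μ α}

/-- `h⁻_μ(𝒰,G) = lim_n H_μ(𝒰_{F_n})/|F_n|` (realized as a `limsup`, equal to the limit
since the limit exists). -/
noncomputable def hMinus (S : GSystem G) [DecidableEq G] (Fn : ℕ → Finset G)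
    (μ : MeasureTheory.Measure S.carrier) (U : Finset (Set S.carrier)) : ℝ :=
  limsup (fun n => covEnt μ (coverJoin S U (Fn n)) / ((Fn n).card : ℝ)) atTop

variable (X : ℕ → GSystem G) (π : ∀ i, FactorMap (X i) (X (i + 1))) [DecidableEq G]

/-- The cover-relative weighted quantities `P^a_{i+1}(Ω, f, F, 𝒰^{(i+1)})` of Section 3
(0-indexed). -/
noncomputable def wPU (a : ℕ → ℝ) (f : (X 0).carrier → ℝ) (F : Finset G)
    (Us : ∀ i, Finset (Set (X i).carrier)) :
    (i : ℕ) → Set (X i).carrier → ℝ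
  | 0, Ω => sInf {s | ∃ V W : Finset (Set (X 0).carrier),
      (⋃₀ (W : Set (Set (X 0).carrier)) = Set.univ) ∧
      Refines W (coverJoin (X 0) (Us 0) F) ∧ V ⊆ W ∧ (Ω ⊆ ⋃₀ (V : Set (Set (X 0).carrier))) ∧
      s = ∑ A ∈ V, Real.exp (sSup (birk (X 0) f F '' A))}
  | i + 1, Ω => sInf {s | ∃ V W : Finset (Set (X (i + 1)).carrier),
      (⋃₀ (W : Set (Set (X (i + 1)).carrier)) = Set.univ) ∧
      Refines W (coverJoin (X (i + 1)) (Us (i + 1)) F) ∧ V ⊆ W ∧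
      (Ω ⊆ ⋃₀ (V : Set (Set (X (i + 1)).carrier))) ∧
      s = ∑ A ∈ V, (wPU a f F Us i ((π i).toFun ⁻¹' A)) ^ (a i)}

/-- `P^a(G,f,𝒰^{(1)},…,𝒰^{(r)}) = lim_n log P^a_r(X_r,f,F_n,𝒰^{(r)})/|F_n|`
(realized as a `limsup` in `EReal`, equal to the limit since the limit exists). -/
noncomputable def pressU (r : ℕ) (a : ℕ → ℝ) (f : (X 0).carrier → ℝ)
    (Fn : ℕ → Finset G) (Us : ∀ i, Finset (Set (X i).carrier)) : EReal :=
  limsup (fun n =>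
    ((Real.log (wPU X π a f (Fn n) Us (r - 1) Set.univ) / ((Fn n).card : ℝ) : ℝ) : EReal)) atTop

end WPP

namespace WPP

variable {G : Type} [Group G]

/-- A finite partition of the space into clopen sets. -/
def IsClopenPartition (S : GSystem G) (U : Finset (Set S.carrier)) : Prop :=
  (∀ A ∈ U, IsClopen A) ∧ (⋃₀ (U : Set (Set S.carrier)) = Set.univ) ∧
    ∀ A ∈ U, ∀ B ∈ U, A ≠ B → A ∩ B = ∅

/-- An admissible family for `Q^a`: finite clopen partitions `𝒰^{(i)}` of `X_i` with
`π_{i−1}^{−1}(𝒰^{(i)}) ⪯ 𝒰^{(i−1)}`, i.e. `𝒰^{(i−1)}` refines the pullback of `𝒰^{(i)}`. -/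
def QAdmissible (X : ℕ → GSystem G) (π : ∀ i, FactorMap (X i) (X (i + 1))) (r : ℕ)
    (Us : ∀ i, Finset (Set (X i).carrier)) : Prop :=
  (∀ i < r, IsClopenPartition (X i) (Us i)) ∧
    ∀ i, i + 1 < r → ∀ A ∈ Us i, ∃ B ∈ Us (i + 1), A ⊆ (π i).toFun ⁻¹' B

end WPP

namespace WPP

lemma limsup_log_div_card_mono {u v : ℕ → ℝ} {α : Type*} (Fn : ℕ → Finset α) (hu : ∀ n, 0 < u n)
    (huv : ∀ n, u n ≤ v n) :
    limsup (fun n => ((Real.log (u n) / ((Fn n).card : ℝ) : ℝ) : EReal)) atTop ≤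
      limsup (fun n => ((Real.log (v n) / ((Fn n).card : ℝ) : ℝ) : EReal)) atTop :=
  limsup_le_limsup (Eventually.of_forall fun n => EReal.coe_le_coe_iff.2
    (div_le_div_of_nonneg_right (Real.log_le_log (hu n) (huv n)) (Nat.cast_nonneg _)))

variable {G : Type} [Group G]

section Covers

variable {S : GSystem G} {F : Finset G} {ε : ℝ}

lemma dynDist_lt_iff (hε : 0 < ε) {x y : S.carrier} :
    dynDist S F x y < ε ↔ ∀ g ∈ F, dist (S.act g x) (S.act g y) < ε := by
  lift ε to ℝ≥0 using hε.le
  rw [dynDist, NNReal.coe_lt_coe, Finset.sup_lt_iff (by simpa using hε)]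
  simp only [← NNReal.coe_lt_coe, coe_nndist]

lemma exists_open_cover_diamLT (S : GSystem G) (F : Finset G) (hε : 0 < ε) :
    ∃ (n : ℕ) (U : Fin n → Set S.carrier),
      (∀ j, IsOpen (U j)) ∧ (Set.univ ⊆ ⋃ j, U j) ∧ ∀ j, diamLT S F (U j) ε := by
  let N : S.carrier → Set S.carrier := fun x =>
    ⋂ g ∈ F, S.act g ⁻¹' Metric.ball (S.act g x) (ε / 2)
  have hN : ∀ x, IsOpen (N x) := fun x =>
    isOpen_biInter_finset fun g _ => Metric.isOpen_ball.preimage (S.cont_act g)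
  have hxN : ∀ x, x ∈ N x := fun x => by simp [N, hε]
  obtain ⟨t, ht⟩ := isCompact_univ.elim_finite_subcover N hN
    fun x _ => Set.mem_iUnion.2 ⟨x, hxN x⟩
  refine ⟨t.card, fun j => N (t.equivFin.symm j), fun j => hN _, fun x hx => ?_,
    fun j y hy z hz => ?_⟩
  · obtain ⟨y, hy, hxy⟩ := Set.mem_iUnion₂.1 (ht hx)
    exact Set.mem_iUnion.2 ⟨t.equivFin ⟨y, hy⟩, by simpa using hxy⟩
  · refine (dynDist_lt_iff hε).2 fun g hg => ?_
    have h₁ := Set.mem_iInter₂.1 hy g hg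
    have h₂ := Set.mem_iInter₂.1 hz g hg
    simp only [Set.mem_preimage, Metric.mem_ball] at h₁ h₂
    linarith [dist_triangle_right (S.act g y) (S.act g z) (S.act g (t.equivFin.symm j).1)]

/-- The infimal total cost of a finite open cover of `Ω` by sets of `d_F`-diameter `< ε`. -/
noncomputable def openCost (S : GSystem G) (F : Finset G) (ε : ℝ) (c : Set S.carrier → ℝ)
    (Ω : Set S.carrier) : ℝ :=
  sInf {s | ∃ (n : ℕ) (U : Fin n → Set S.carrier),
    (∀ j, IsOpen (U j)) ∧ (Ω ⊆ ⋃ j, U j) ∧ (∀ j, diamLT S F (U j) ε) ∧ s = ∑ j, c (U j)}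

/-- The infimal total cost of a cover of `Ω` by members of finite covers refining `𝒰_F`. -/
noncomputable def joinCost [DecidableEq G] (S : GSystem G) (F : Finset G)
    (U : Finset (Set S.carrier)) (c : Set S.carrier → ℝ) (Ω : Set S.carrier) : ℝ :=
  sInf {s | ∃ V W : Finset (Set S.carrier),
    (⋃₀ (W : Set (Set S.carrier)) = Set.univ) ∧ Refines W (coverJoin S U F) ∧ V ⊆ W ∧
    (Ω ⊆ ⋃₀ (V : Set (Set S.carrier))) ∧ s = ∑ A ∈ V, c A}

variable {c c' : Set S.carrier → ℝ} {Ω Ω' : Set S.carrier}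

lemma openCost_set_nonempty (hε : 0 < ε) (c : Set S.carrier → ℝ) (Ω : Set S.carrier) :
    {s | ∃ (n : ℕ) (U : Fin n → Set S.carrier), (∀ j, IsOpen (U j)) ∧ (Ω ⊆ ⋃ j, U j) ∧
      (∀ j, diamLT S F (U j) ε) ∧ s = ∑ j, c (U j)}.Nonempty := by
  obtain ⟨n, U, hU, hcov, hd⟩ := exists_open_cover_diamLT S F hε
  exact ⟨_, n, U, hU, (Set.subset_univ _).trans hcov, hd, rfl⟩

lemma openCost_nonneg (hc : ∀ A, 0 ≤ c A) : 0 ≤ openCost S F ε c Ω := by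
  refine Real.sInf_nonneg ?_
  rintro _ ⟨n, U, -, -, -, rfl⟩
  exact Finset.sum_nonneg fun j _ => hc _

lemma openCost_le_sum (hc : ∀ A, 0 ≤ c A) {n : ℕ} {U : Fin n → Set S.carrier}
    (hU : ∀ j, IsOpen (U j)) (hcov : Ω ⊆ ⋃ j, U j) (hd : ∀ j, diamLT S F (U j) ε) :
    openCost S F ε c Ω ≤ ∑ j, c (U j) := by
  refine csInf_le ⟨0, ?_⟩ ⟨n, U, hU, hcov, hd, rfl⟩
  rintro _ ⟨n, U, -, -, -, rfl⟩
  exact Finset.sum_nonneg fun j _ => hc _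

lemma openCost_le_sum_finset (hc : ∀ A, 0 ≤ c A) {ι : Type} {t : Finset ι}
    {U : ι → Set S.carrier} (hU : ∀ i ∈ t, IsOpen (U i)) (hcov : Ω ⊆ ⋃ i ∈ t, U i)
    (hd : ∀ i ∈ t, diamLT S F (U i) ε) :
    openCost S F ε c Ω ≤ ∑ i ∈ t, c (U i) := by
  refine (openCost_le_sum hc (U := fun j => U (t.equivFin.symm j))
    (fun j => hU _ (t.equivFin.symm j).2) (fun x hx => ?_)
    fun j => hd _ (t.equivFin.symm j).2).trans_eq ?_
  · obtain ⟨i, hi, hxi⟩ := Set.mem_iUnion₂.1 (hcov hx)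
    exact Set.mem_iUnion.2 ⟨t.equivFin ⟨i, hi⟩, by simpa using hxi⟩
  · rw [Equiv.sum_comp t.equivFin.symm fun i : t => c (U i), Finset.sum_coe_sort t fun i => c (U i)]

lemma openCost_mono (hε : 0 < ε) (hc : ∀ A, 0 ≤ c A) (h : Ω ⊆ Ω') :
    openCost S F ε c Ω ≤ openCost S F ε c Ω' := by
  refine le_csInf (openCost_set_nonempty hε c Ω') ?_
  rintro _ ⟨n, U, hU, hcov, hd, rfl⟩
  exact openCost_le_sum hc hU (h.trans hcov) hd

lemma openCost_empty (hc : ∀ A, 0 ≤ c A) : openCost S F ε c ∅ = 0 := by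
  refine le_antisymm ?_ (openCost_nonneg hc)
  simpa using openCost_le_sum hc (n := 0) (U := fun _ => ∅) (fun j => j.elim0)
    (Set.empty_subset _) fun j => j.elim0

lemma exists_open_superset_openCost_lt (hε : 0 < ε) (hc : ∀ A, 0 ≤ c A) {t : ℝ}
    (ht : openCost S F ε c Ω < t) :
    ∃ O, IsOpen O ∧ Ω ⊆ O ∧ openCost S F ε c O < t := by
  obtain ⟨_, ⟨n, U, hU, hcov, hd, rfl⟩, hs⟩ :=
    exists_lt_of_csInf_lt (openCost_set_nonempty hε c Ω) ht
  exact ⟨⋃ j, U j, isOpen_iUnion hU, hcov, (openCost_le_sum hc hU subset_rfl hd).trans_lt hs⟩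

lemma le_openCost (hε : 0 < ε) (hc : ∀ A, 0 ≤ c A) {m : ℝ}
    (hm : ∀ A : Set S.carrier, A.Nonempty → m ≤ c A) (hΩ : Ω.Nonempty) :
    m ≤ openCost S F ε c Ω := by
  refine le_csInf (openCost_set_nonempty hε c Ω) ?_
  rintro _ ⟨n, U, hU, hcov, hd, rfl⟩
  obtain ⟨x, hx⟩ := hΩ
  obtain ⟨j, hj⟩ := Set.mem_iUnion.1 (hcov hx)
  exact (hm _ ⟨x, hj⟩).trans
    (Finset.single_le_sum (f := fun j => c (U j)) (fun j _ => hc _) (Finset.mem_univ j))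

variable [DecidableEq G] {U : Finset (Set S.carrier)}

lemma mem_coverJoin {B : Set S.carrier} :
    B ∈ coverJoin S U F ↔
      ∃ b : ∀ g ∈ F, Set S.carrier, (∀ g hg, b g hg ∈ U) ∧
        ⋂ g, ⋂ (h : g ∈ F), S.act g ⁻¹' b g h = B := by
  simp [coverJoin]

lemma sUnion_coverJoin (hU : ⋃₀ (U : Set (Set S.carrier)) = Set.univ) :
    ⋃₀ (coverJoin S U F : Set (Set S.carrier)) = Set.univ := by
  refine Set.eq_univ_of_forall fun x => ?_
  choose b hb hxb using fun y => Set.mem_sUnion.1 (hU.ge (Set.mem_univ y))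
  exact ⟨_, mem_coverJoin.2 ⟨fun g _ => b (S.act g x), fun g _ => hb _, rfl⟩, by simp [hxb]⟩

lemma isOpen_of_mem_coverJoin (hU : ∀ A ∈ U, IsOpen A) {B : Set S.carrier}
    (hB : B ∈ coverJoin S U F) : IsOpen B := by
  obtain ⟨b, hb, rfl⟩ := mem_coverJoin.1 hB
  have h : (⋂ g, ⋂ (h : g ∈ F), S.act g ⁻¹' b g h) =
      ⋂ g : F, S.act g ⁻¹' b g g.2 := by
    ext x; simp
  rw [h]
  exact isOpen_iInter_of_finite fun g => (hU _ (hb _ _)).preimage (S.cont_act g)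

lemma diamLT_of_mem_coverJoin (hε : 0 < ε)
    (hU : ∀ A ∈ U, ∀ x ∈ A, ∀ y ∈ A, dist x y < ε) {B : Set S.carrier}
    (hB : B ∈ coverJoin S U F) : diamLT S F B ε := by
  obtain ⟨b, hb, rfl⟩ := mem_coverJoin.1 hB
  intro x hx y hy
  refine (dynDist_lt_iff hε).2 fun g hg => hU _ (hb g hg) _ ?_ _ ?_
  · exact Set.mem_iInter₂.1 hx g hg
  · exact Set.mem_iInter₂.1 hy g hg

lemma exists_mem_coverJoin_superset (hε : 0 < ε)
    (hU : ∀ A : Set S.carrier, (∀ x ∈ A, ∀ y ∈ A, dist x y < ε) → ∃ B ∈ U, A ⊆ B)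
    {A : Set S.carrier} (hA : diamLT S F A ε) : ∃ B ∈ coverJoin S U F, A ⊆ B := by
  have h : ∀ g ∈ F, ∃ B ∈ U, S.act g '' A ⊆ B := by
    refine fun g hg => hU _ ?_
    rintro _ ⟨x, hx, rfl⟩ _ ⟨y, hy, rfl⟩
    exact (dynDist_lt_iff hε).1 (hA x hx y hy) g hg
  choose b hb hAb using h
  refine ⟨_, mem_coverJoin.2 ⟨b, hb, rfl⟩, fun x hx => ?_⟩
  exact Set.mem_iInter₂.2 fun g hg => hAb g hg ⟨x, hx, rfl⟩

lemma joinCost_nonneg (hc : ∀ A, 0 ≤ c A) : 0 ≤ joinCost S F U c Ω := by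
  refine Real.sInf_nonneg ?_
  rintro _ ⟨V, W, -, -, -, -, rfl⟩
  exact Finset.sum_nonneg fun A _ => hc _

lemma joinCost_le_sum (hc : ∀ A, 0 ≤ c A) {V W : Finset (Set S.carrier)}
    (hW : ⋃₀ (W : Set (Set S.carrier)) = Set.univ) (hWU : Refines W (coverJoin S U F))
    (hVW : V ⊆ W) (hcov : Ω ⊆ ⋃₀ (V : Set (Set S.carrier))) :
    joinCost S F U c Ω ≤ ∑ A ∈ V, c A := by
  refine csInf_le ⟨0, ?_⟩ ⟨V, W, hW, hWU, hVW, hcov, rfl⟩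
  rintro _ ⟨V, W, -, -, -, -, rfl⟩
  exact Finset.sum_nonneg fun A _ => hc _

lemma joinCost_of_isEmpty [IsEmpty S.carrier] (hc : ∀ A, 0 ≤ c A) : joinCost S F U c Ω = 0 := by
  refine le_antisymm ?_ (joinCost_nonneg hc)
  simpa using joinCost_le_sum (V := ∅) (W := ∅) hc (Subsingleton.elim _ _)
    (by simp [Refines]) subset_rfl fun x => isEmptyElim x

/-- If `𝒰` is a fine open cover, and the cost `c'` is approximated from above by `c` on open
neighbourhoods, then optimal covers for `𝒰_F` can be fattened to open covers. -/
lemma openCost_le_joinCost (hε : 0 < ε) (hc : ∀ A, 0 ≤ c A)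
    (hUo : ∀ A ∈ U, IsOpen A) (hUc : ⋃₀ (U : Set (Set S.carrier)) = Set.univ)
    (hUd : ∀ A ∈ U, ∀ x ∈ A, ∀ y ∈ A, dist x y < ε)
    (hcc' : ∀ A B : Set S.carrier, IsOpen B → A ⊆ B → ∀ η > 0,
      ∃ A', IsOpen A' ∧ A ⊆ A' ∧ A' ⊆ B ∧ c A' ≤ c' A + η) :
    openCost S F ε c Ω ≤ joinCost S F U c' Ω := by
  refine le_csInf ⟨_, coverJoin S U F, coverJoin S U F, sUnion_coverJoin hUc,
    fun A hA => ⟨A, hA, subset_rfl⟩, subset_rfl,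
    (Set.subset_univ Ω).trans (sUnion_coverJoin hUc).ge, rfl⟩ ?_
  rintro _ ⟨V, W, -, hWU, hVW, hcov, rfl⟩
  refine le_of_forall_pos_le_add fun θ hθ => ?_
  have hη : 0 < θ / (V.card + 1) := by positivity
  have h : ∀ A ∈ V, ∃ A', IsOpen A' ∧ A ⊆ A' ∧ diamLT S F A' ε ∧
      c A' ≤ c' A + θ / (V.card + 1) := by
    intro A hA
    obtain ⟨B, hB, hAB⟩ := hWU A (hVW hA)
    obtain ⟨A', hA', hAA', hA'B, hcA⟩ := hcc' A B (isOpen_of_mem_coverJoin hUo hB) hAB _ hη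
    exact ⟨A', hA', hAA', fun x hx y hy =>
      diamLT_of_mem_coverJoin hε hUd hB x (hA'B hx) y (hA'B hy), hcA⟩
  choose! T hTo hAT hTd hTc using h
  calc openCost S F ε c Ω ≤ ∑ A ∈ V, c (T A) := by
        refine openCost_le_sum_finset hc hTo (fun x hx => ?_) hTd
        obtain ⟨A, hA, hxA⟩ := hcov hx
        exact Set.mem_iUnion₂.2 ⟨A, hA, hAT A hA hxA⟩
    _ ≤ ∑ A ∈ V, (c' A + θ / (V.card + 1)) := Finset.sum_le_sum hTc
    _ = ∑ A ∈ V, c' A + V.card * (θ / (V.card + 1)) := by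
        rw [Finset.sum_add_distrib, Finset.sum_const, nsmul_eq_mul]
    _ ≤ ∑ A ∈ V, c' A + θ := by
        gcongr
        rw [mul_div_assoc', div_le_iff₀ (by positivity)]
        nlinarith

lemma joinCost_le_openCost (hε : 0 < ε) (hc : ∀ A, 0 ≤ c A) (hcc' : ∀ A, c A ≤ c' A)
    (hUc : ⋃₀ (U : Set (Set S.carrier)) = Set.univ)
    (hU : ∀ A : Set S.carrier, (∀ x ∈ A, ∀ y ∈ A, dist x y < ε) → ∃ B ∈ U, A ⊆ B) :
    joinCost S F U c Ω ≤ openCost S F ε c' Ω := by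
  classical
  refine le_csInf (openCost_set_nonempty hε c' Ω) ?_
  rintro _ ⟨n, T, -, hcov, hd, rfl⟩
  calc joinCost S F U c Ω ≤ ∑ A ∈ Finset.univ.image T, c A := by
        refine joinCost_le_sum (W := Finset.univ.image T ∪ coverJoin S U F) hc ?_ ?_
          Finset.subset_union_left (by simpa using hcov)
        · rw [Finset.coe_union, Set.sUnion_union, sUnion_coverJoin hUc, Set.union_univ]
        · intro A hA
          rcases Finset.mem_union.1 hA with hA | hA
          · obtain ⟨j, -, rfl⟩ := Finset.mem_image.1 hA
            exact exists_mem_coverJoin_superset hε hU (hd j)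
          · exact ⟨A, hA, subset_rfl⟩
    _ ≤ ∑ j, c (T j) := Finset.sum_image_le_of_nonneg fun A _ => hc A
    _ ≤ ∑ j, c' (T j) := Finset.sum_le_sum fun j _ => hcc' _

end Covers

section Partitions

lemma IsClopenPartition.exists_lebesgue_number {S : GSystem G} {U : Finset (Set S.carrier)}
    (hU : IsClopenPartition S U) [Nonempty S.carrier] :
    ∃ ε > 0, ∀ A : Set S.carrier, (∀ x ∈ A, ∀ y ∈ A, dist x y < ε) → ∃ B ∈ U, A ⊆ B := by
  obtain ⟨ε, hε, h⟩ := lebesgue_number_lemma_of_metric_sUnion (isCompact_univ (X := S.carrier))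
    (fun A hA => (hU.1 A hA).isOpen) hU.2.1.ge
  refine ⟨ε, hε, fun A hA => ?_⟩
  rcases A.eq_empty_or_nonempty with rfl | ⟨x, hx⟩
  · obtain ⟨B, hB, -⟩ := h (Classical.arbitrary _) trivial
    exact ⟨B, hB, Set.empty_subset _⟩
  · obtain ⟨B, hB, hxB⟩ := h x trivial
    exact ⟨B, hB, fun y hy => hxB (hA y hy x hx)⟩

lemma exists_isClopenPartition_dist_lt (S : GSystem G) [TotallyDisconnectedSpace S.carrier]
    {δ : ℝ} (hδ : 0 < δ) :
    ∃ U : Finset (Set S.carrier), IsClopenPartition S U ∧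
      ∀ A ∈ U, A.Nonempty ∧ ∀ x ∈ A, ∀ y ∈ A, dist x y < δ := by
  classical
  obtain ⟨n, D, hD, hDd, hDc, hDD⟩ :=
    ContinuousMap.exists_disjoint_nonempty_clopen_cover_of_mem_nhds_diagonal
      (ContinuousMap.id S.carrier) (S := {p | dist p.1 p.2 < δ})
      ((isOpen_lt continuous_dist continuous_const).mem_nhdsSet.2 fun p hp => by
        rw [Set.mem_diagonal_iff] at hp
        simpa [hp] using hδ)
  refine ⟨Finset.univ.image fun i => (D i : Set S.carrier), ⟨?_, ?_, ?_⟩, ?_⟩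
  · simpa using fun i => (D i).isClopen
  · simpa [Set.univ_subset_iff] using hDc
  · simp only [Finset.mem_image, Finset.mem_univ, true_and]
    rintro _ ⟨i, rfl⟩ _ ⟨j, rfl⟩ hij
    have h : Disjoint (D i) (D j) := hDD fun h => hij (by rw [h])
    exact Set.disjoint_iff_inter_eq_empty.1 (TopologicalSpace.Clopens.coe_disjoint.2 h)
  · simp only [Finset.mem_image, Finset.mem_univ, true_and]
    rintro _ ⟨i, rfl⟩
    refine ⟨Set.nonempty_iff_ne_empty.2 fun h => hD i (SetLike.coe_injective (by simpa using h)),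
      fun x hx y hy => hDd i x hx y hy⟩

lemma exists_QAdmissible_dist_lt (X : ℕ → GSystem G) (π : ∀ i, FactorMap (X i) (X (i + 1)))
    (r : ℕ) (hzd : ∀ i < r, TotallyDisconnectedSpace (X i).carrier) {δ : ℝ} (hδ : 0 < δ) :
    ∃ Us : ∀ i, Finset (Set (X i).carrier), QAdmissible X π r Us ∧
      ∀ i < r, ∀ A ∈ Us i, ∀ x ∈ A, ∀ y ∈ A, dist x y < δ := by
  suffices h : ∀ k ≤ r, ∃ Us : ∀ i, Finset (Set (X i).carrier),
      ∀ i, r ≤ i + k → i < r → IsClopenPartition (X i) (Us i) ∧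
        (i + 1 < r → ∀ A ∈ Us i, ∃ B ∈ Us (i + 1), A ⊆ (π i).toFun ⁻¹' B) ∧
        ∀ A ∈ Us i, ∀ x ∈ A, ∀ y ∈ A, dist x y < δ by
    obtain ⟨Us, hUs⟩ := h r le_rfl
    exact ⟨Us, ⟨fun i hi => (hUs i (by lia) hi).1,
      fun i hi => (hUs i (by lia) (by lia)).2.1 hi⟩, fun i hi => (hUs i (by lia) hi).2.2⟩
  intro k
  induction k with
  | zero => exact fun _ => ⟨fun _ => ∅, fun i h₁ h₂ => by lia⟩
  | succ k ih =>
    intro hk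
    obtain ⟨Us, hUs⟩ := ih (by lia)
    obtain ⟨m, hm⟩ : ∃ m, m + (k + 1) = r := ⟨r - (k + 1), by lia⟩
    have : TotallyDisconnectedSpace (X m).carrier := hzd m (by lia)
    obtain ⟨P, hP, hPd, hPU⟩ : ∃ P : Finset (Set (X m).carrier), IsClopenPartition (X m) P ∧
        (∀ A ∈ P, ∀ x ∈ A, ∀ y ∈ A, dist x y < δ) ∧
        (m + 1 < r → ∀ A ∈ P, ∃ B ∈ Us (m + 1), A ⊆ (π m).toFun ⁻¹' B) := by
      by_cases hmr : m + 1 < r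
      · have hU := (hUs (m + 1) (by lia) hmr).1
        obtain ⟨ε, hε, hεU⟩ := lebesgue_number_lemma_of_metric
          (isCompact_univ (X := (X m).carrier))
          (c := fun B : Us (m + 1) => (π m).toFun ⁻¹' (B : Set (X (m + 1)).carrier))
          (fun B => (hU.1 B B.2).isOpen.preimage (π m).cont) fun x _ => by
            obtain ⟨B, hB, hxB⟩ := hU.2.1.ge (Set.mem_univ ((π m).toFun x))
            exact Set.mem_iUnion.2 ⟨⟨B, hB⟩, hxB⟩
        obtain ⟨P, hP, hPd⟩ := exists_isClopenPartition_dist_lt (X m) (lt_min hδ hε)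
        refine ⟨P, hP, fun A hA x hx y hy => ((hPd A hA).2 x hx y hy).trans_le (min_le_left _ _),
          fun _ A hA => ?_⟩
        obtain ⟨x, hx⟩ := (hPd A hA).1
        obtain ⟨B, hB⟩ := hεU x trivial
        exact ⟨B, B.2, fun y hy => hB (((hPd A hA).2 y hy x hx).trans_le (min_le_right _ _))⟩
      · obtain ⟨P, hP, hPd⟩ := exists_isClopenPartition_dist_lt (X m) hδ
        exact ⟨P, hP, fun A hA => (hPd A hA).2, fun h => absurd h hmr⟩
    refine ⟨Function.update Us m P, fun i hi hir => ?_⟩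
    rw [Function.update_of_ne (show i + 1 ≠ m by lia)]
    rcases eq_or_ne i m with rfl | him
    · rw [Function.update_self]
      exact ⟨hP, hPU, hPd⟩
    · rw [Function.update_of_ne him]
      exact hUs i (by lia) hir

end Partitions

section Weighted

variable {X : ℕ → GSystem G} {π : ∀ i, FactorMap (X i) (X (i + 1))} {a : ℕ → ℝ}
  {f : (X 0).carrier → ℝ} {F : Finset G} {ε : ℝ}

lemma wP_zero : wP X π a f F ε 0 =
    openCost (X 0) F ε fun A => Real.exp (sSup (birk (X 0) f F '' A)) := rfl

lemma wP_succ (i : ℕ) : wP X π a f F ε (i + 1) =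
    openCost (X (i + 1)) F ε fun A => wP X π a f F ε i ((π i).toFun ⁻¹' A) ^ a i := rfl

lemma wP_nonneg (i : ℕ) (Ω : Set (X i).carrier) : 0 ≤ wP X π a f F ε i Ω := by
  induction i with
  | zero => rw [wP_zero]; exact openCost_nonneg fun _ => (Real.exp_pos _).le
  | succ i ih => rw [wP_succ]; exact openCost_nonneg fun _ => Real.rpow_nonneg (ih _) _

/-- `P^a_{i+1}(·, f, F, ε)` is an optimal cover cost for some nonnegative cost function. -/
lemma exists_wP_eq_openCost (i : ℕ) :
    ∃ c : Set (X i).carrier → ℝ, (∀ A, 0 ≤ c A) ∧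
      wP X π a f F ε i = openCost (X i) F ε c := by
  cases i with
  | zero => exact ⟨_, fun _ => (Real.exp_pos _).le, wP_zero⟩
  | succ i => exact ⟨_, fun _ => Real.rpow_nonneg (wP_nonneg i _) _, wP_succ i⟩

lemma wP_mono (hε : 0 < ε) (i : ℕ) {Ω Ω' : Set (X i).carrier} (h : Ω ⊆ Ω') :
    wP X π a f F ε i Ω ≤ wP X π a f F ε i Ω' := by
  obtain ⟨c, hc, hP⟩ := exists_wP_eq_openCost (π := π) (a := a) (f := f) (F := F) (ε := ε) i
  rw [hP]
  exact openCost_mono hε hc h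

lemma wP_empty (i : ℕ) : wP X π a f F ε i ∅ = 0 := by
  obtain ⟨c, hc, hP⟩ := exists_wP_eq_openCost (π := π) (a := a) (f := f) (F := F) (ε := ε) i
  rw [hP]
  exact openCost_empty hc

lemma exists_open_superset_wP_lt (hε : 0 < ε) (i : ℕ) {Ω : Set (X i).carrier} {t : ℝ}
    (h : wP X π a f F ε i Ω < t) : ∃ O, IsOpen O ∧ Ω ⊆ O ∧ wP X π a f F ε i O < t := by
  obtain ⟨c, hc, hP⟩ := exists_wP_eq_openCost (π := π) (a := a) (f := f) (F := F) (ε := ε) i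
  rw [hP] at h ⊢
  exact exists_open_superset_openCost_lt hε hc h

lemma continuous_birk {S : GSystem G} {f : S.carrier → ℝ} (hf : Continuous f) (F : Finset G) :
    Continuous (birk S f F) :=
  continuous_finsetSum _ fun g _ => hf.comp (S.cont_act g)

lemma bddAbove_birk_image {S : GSystem G} {f : S.carrier → ℝ} (hf : Continuous f) (F : Finset G)
    (A : Set S.carrier) : BddAbove (birk S f F '' A) :=
  (isCompact_range (continuous_birk hf F)).bddAbove.mono (Set.image_subset_range _ _)

lemma exists_pos_le_wP (hε : 0 < ε) (hf : Continuous f) {r : ℕ}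
    (ha : ∀ i < r - 1, 0 ≤ a i) (i : ℕ) (hi : i < r) :
    ∃ m > 0, ∀ Ω : Set (X i).carrier, Ω.Nonempty → m ≤ wP X π a f F ε i Ω := by
  induction i with
  | zero =>
    obtain ⟨b, hb⟩ := (isCompact_range (continuous_birk hf F)).bddBelow
    refine ⟨Real.exp b, Real.exp_pos b, fun Ω hΩ => ?_⟩
    rw [wP_zero]
    refine le_openCost hε (fun _ => (Real.exp_pos _).le) (fun A ⟨x, hx⟩ => ?_) hΩ
    exact Real.exp_le_exp.2 ((hb ⟨x, rfl⟩).trans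
      (le_csSup (bddAbove_birk_image hf F A) ⟨x, hx, rfl⟩))
  | succ i ih =>
    obtain ⟨m, hm, hmP⟩ := ih (by lia)
    refine ⟨m ^ a i, Real.rpow_pos_of_pos hm _, fun Ω hΩ => ?_⟩
    rw [wP_succ]
    exact le_openCost hε (fun _ => Real.rpow_nonneg (wP_nonneg i _) _) (fun A hA =>
      Real.rpow_le_rpow hm.le (hmP _ (hA.preimage (π i).surj)) (ha i (by lia))) hΩ

lemma exists_gt_lt_add {g : ℝ → ℝ} {x η : ℝ} (hg : ContinuousAt g x) (hη : 0 < η) :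
    ∃ t > x, g t < g x + η := by
  have h : ∀ᶠ t in nhdsWithin x (Set.Ioi x), g t < g x + η :=
    nhdsWithin_le_nhds (hg.eventually_lt_const (lt_add_of_pos_right _ hη))
  obtain ⟨t, ht, hxt⟩ := (h.and self_mem_nhdsWithin).exists
  exact ⟨t, hxt, ht⟩

lemma exists_open_exp_sSup_birk_le {S : GSystem G} {f : S.carrier → ℝ} (hf : Continuous f)
    {A B : Set S.carrier} (hB : IsOpen B) (hAB : A ⊆ B) {η : ℝ} (hη : 0 < η) :
    ∃ A', IsOpen A' ∧ A ⊆ A' ∧ A' ⊆ B ∧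
      Real.exp (sSup (birk S f F '' A')) ≤ Real.exp (sSup (birk S f F '' A)) + η := by
  obtain ⟨t, ht, htη⟩ := exists_gt_lt_add (x := sSup (birk S f F '' A))
    Real.continuous_exp.continuousAt hη
  refine ⟨B ∩ birk S f F ⁻¹' Set.Iio t, hB.inter (isOpen_Iio.preimage (continuous_birk hf F)),
    fun x hx => ⟨hAB hx, (le_csSup (bddAbove_birk_image hf F A) ⟨x, hx, rfl⟩).trans_lt ht⟩,
    Set.inter_subset_left, ?_⟩
  rcases A.eq_empty_or_nonempty with rfl | hA
  · rcases (B ∩ birk S f F ⁻¹' Set.Iio t).eq_empty_or_nonempty with h | h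
    · rw [h]
      exact le_add_of_nonneg_right hη.le
    · refine (Real.exp_le_exp.2 (csSup_le (h.image _) ?_)).trans htη.le
      rintro _ ⟨x, hx, rfl⟩
      exact hx.2.le
  · refine (Real.exp_le_exp.2 (csSup_le (Set.Nonempty.image _ ?_) ?_)).trans htη.le
    · obtain ⟨x, hx⟩ := hA
      exact ⟨x, hAB hx, (le_csSup (bddAbove_birk_image hf F A) ⟨x, hx, rfl⟩).trans_lt ht⟩
    · rintro _ ⟨x, hx, rfl⟩
      exact hx.2.le

lemma exists_open_preimage_subset {S T : GSystem G} (p : FactorMap S T) {A B : Set T.carrier}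
    {O : Set S.carrier} (hB : IsOpen B) (hAB : A ⊆ B) (hO : IsOpen O) (hAO : p.toFun ⁻¹' A ⊆ O) :
    ∃ A', IsOpen A' ∧ A ⊆ A' ∧ A' ⊆ B ∧ p.toFun ⁻¹' A' ⊆ O := by
  refine ⟨B ∩ (p.toFun '' Oᶜ)ᶜ, hB.inter (p.cont.isClosedMap _ hO.isClosed_compl).isOpen_compl,
    fun y hy => ⟨hAB hy, ?_⟩, Set.inter_subset_left, fun x hx => ?_⟩
  · rintro ⟨x, hx, rfl⟩
    exact hx (hAO hy)
  · by_contra h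
    exact hx.2 ⟨x, h, rfl⟩

variable [DecidableEq G] {Us : ∀ i, Finset (Set (X i).carrier)}

lemma wPU_zero : wPU X π a f F Us 0 =
    joinCost (X 0) F (Us 0) fun A => Real.exp (sSup (birk (X 0) f F '' A)) := rfl

lemma wPU_succ (i : ℕ) : wPU X π a f F Us (i + 1) =
    joinCost (X (i + 1)) F (Us (i + 1)) fun A =>
      wPU X π a f F Us i ((π i).toFun ⁻¹' A) ^ a i := rfl

lemma wPU_nonneg (i : ℕ) (Ω : Set (X i).carrier) : 0 ≤ wPU X π a f F Us i Ω := by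
  induction i with
  | zero => rw [wPU_zero]; exact joinCost_nonneg fun _ => (Real.exp_pos _).le
  | succ i ih => rw [wPU_succ]; exact joinCost_nonneg fun _ => Real.rpow_nonneg (ih _) _

lemma wPU_of_isEmpty (i : ℕ) [IsEmpty (X i).carrier] (Ω : Set (X i).carrier) :
    wPU X π a f F Us i Ω = 0 := by
  cases i with
  | zero => rw [wPU_zero]; exact joinCost_of_isEmpty fun _ => (Real.exp_pos _).le
  | succ i => rw [wPU_succ]; exact joinCost_of_isEmpty fun _ => Real.rpow_nonneg (wPU_nonneg i _) _

lemma wP_le_wPU (hε : 0 < ε) (hf : Continuous f) {r : ℕ} (ha : ∀ i < r - 1, 0 ≤ a i)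
    (hUs : ∀ i < r, IsClopenPartition (X i) (Us i))
    (hd : ∀ i < r, ∀ A ∈ Us i, ∀ x ∈ A, ∀ y ∈ A, dist x y < ε) (i : ℕ) (hi : i < r)
    (Ω : Set (X i).carrier) : wP X π a f F ε i Ω ≤ wPU X π a f F Us i Ω := by
  induction i with
  | zero =>
    rw [wP_zero, wPU_zero]
    exact openCost_le_joinCost hε (fun _ => (Real.exp_pos _).le)
      (fun A hA => ((hUs 0 hi).1 A hA).isOpen) (hUs 0 hi).2.1 (hd 0 hi)
      fun A B hB hAB η hη => exists_open_exp_sSup_birk_le hf hB hAB hη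
  | succ i ih =>
    have hai : 0 ≤ a i := ha i (by lia)
    rw [wP_succ, wPU_succ]
    refine openCost_le_joinCost hε (fun _ => Real.rpow_nonneg (wP_nonneg i _) _)
      (fun A hA => ((hUs _ hi).1 A hA).isOpen) (hUs _ hi).2.1 (hd _ hi) fun A B hB hAB η hη => ?_
    obtain ⟨t, ht, htη⟩ := exists_gt_lt_add (x := wP X π a f F ε i ((π i).toFun ⁻¹' A))
      (Real.continuousAt_rpow_const _ _ (.inr hai)) hη
    obtain ⟨O, hO, hAO, hOt⟩ := exists_open_superset_wP_lt hε i ht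
    obtain ⟨A', hA', hAA', hA'B, hA'O⟩ := exists_open_preimage_subset (π i) hB hAB hO hAO
    refine ⟨A', hA', hAA', hA'B, ?_⟩
    calc wP X π a f F ε i ((π i).toFun ⁻¹' A') ^ a i ≤ t ^ a i :=
          Real.rpow_le_rpow (wP_nonneg i _) ((wP_mono hε i hA'O).trans hOt.le) hai
      _ ≤ wP X π a f F ε i ((π i).toFun ⁻¹' A) ^ a i + η := htη.le
      _ ≤ wPU X π a f F Us i ((π i).toFun ⁻¹' A) ^ a i + η := by
          gcongr
          · exact wP_nonneg i _
          · exact ih (by lia) _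

lemma wPU_le_wP (hε : 0 < ε) {r : ℕ} (ha : ∀ i < r - 1, 0 ≤ a i)
    (hUs : ∀ i < r, IsClopenPartition (X i) (Us i))
    (hL : ∀ i < r, ∀ A : Set (X i).carrier, (∀ x ∈ A, ∀ y ∈ A, dist x y < ε) →
      ∃ B ∈ Us i, A ⊆ B) (i : ℕ) (hi : i < r)
    (Ω : Set (X i).carrier) : wPU X π a f F Us i Ω ≤ wP X π a f F ε i Ω := by
  induction i with
  | zero =>
    rw [wP_zero, wPU_zero]
    exact joinCost_le_openCost hε (fun _ => (Real.exp_pos _).le) (fun _ => le_rfl)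
      (hUs 0 hi).2.1 (hL 0 hi)
  | succ i ih =>
    rw [wP_succ, wPU_succ]
    exact joinCost_le_openCost hε (fun _ => Real.rpow_nonneg (wPU_nonneg i _) _)
      (fun _ => Real.rpow_le_rpow (wPU_nonneg i _) (ih (by lia) _) (ha i (by lia)))
      (hUs _ hi).2.1 (hL _ hi)

end Weighted

lemma isEmpty_carrier {X : ℕ → GSystem G} (π : ∀ i, FactorMap (X i) (X (i + 1)))
    [IsEmpty (X 0).carrier] (i : ℕ) : IsEmpty (X i).carrier := by
  induction i with
  | zero => assumption
  | succ i ih => exact (π i).surj.isEmpty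

lemma nonempty_carrier {X : ℕ → GSystem G} (π : ∀ i, FactorMap (X i) (X (i + 1)))
    [h : Nonempty (X 0).carrier] : ∀ i, Nonempty (X i).carrier
  | 0 => h
  | i + 1 => (nonempty_carrier π i).map (π i).toFun

end WPP

open WPP Filter in
/-- Claim 4.3: for zero-dimensional `G`-systems `(X_i,G)`, `P^a(f,G) = Q^a(G,f,π)`,
where `Q^a(G,f,π)` is the limit of `Q^a(G,f,𝒰^{(1)},…,𝒰^{(r)})` as the maximal diameter
of the clopen partitions `𝒰^{(i)}` tends to `0`, the limit being taken over families of
finite clopen partitions `𝒰^{(i)}` of `X_i` satisfying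
`π_{i−1}^{−1}(𝒰^{(i)}) ⪯ 𝒰^{(i−1)}` for `i = 2,…,r`.  (The convergence "as the maximal
diameter tends to `0`" is expressed by `Tendsto` along the filter
`⨅ δ > 0, 𝓟 {admissible families all of whose members have diameter < δ}`.) -/
theorem pressure_eq_Q_zero_dimensional
    {G : Type} [Group G] [Countable G] [Infinite G] [DecidableEq G]
    (Fn : ℕ → Finset G) (hFn : IsFolner G Fn)
    (X : ℕ → GSystem G) (π : ∀ i, FactorMap (X i) (X (i + 1)))
    (r : ℕ) (hr : 2 ≤ r) (a : ℕ → ℝ) (ha : ∀ i < r - 1, a i ∈ Set.Icc (0 : ℝ) 1)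
    (hzd : ∀ i < r, TotallyDisconnectedSpace (X i).carrier)
    (f : (X 0).carrier → ℝ) (hf : Continuous f)
    (L : EReal)
    (hL : Tendsto (fun Us : ∀ i, Finset (Set (X i).carrier) => pressU X π r a f Fn Us)
      (⨅ (δ : ℝ) (_ : 0 < δ), Filter.principal
        {Us : ∀ i, Finset (Set (X i).carrier) | QAdmissible X π r Us ∧
          ∀ i < r, ∀ A ∈ Us i, ∀ x ∈ A, ∀ y ∈ A, dist x y < δ})
      (nhds L)) :
    press X π r a f Fn = L := by
  set 𝓕 := ⨅ (δ : ℝ) (_ : 0 < δ), Filter.principal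
    {Us : ∀ i, Finset (Set (X i).carrier) | QAdmissible X π r Us ∧
      ∀ i < r, ∀ A ∈ Us i, ∀ x ∈ A, ∀ y ∈ A, dist x y < δ}
  have h_basis : 𝓕.HasBasis (fun δ : ℝ => 0 < δ) fun δ =>
      {Us : ∀ i, Finset (Set (X i).carrier) | QAdmissible X π r Us ∧
        ∀ i < r, ∀ A ∈ Us i, ∀ x ∈ A, ∀ y ∈ A, dist x y < δ} :=
    hasBasis_biInf_principal (fun δ hδ δ' hδ' => ⟨min δ δ', lt_min (Set.mem_Ioi.1 hδ) (Set.mem_Ioi.1 hδ'),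
      fun Us hUs => ⟨hUs.1, fun i hi A hA x hx y hy =>
        (hUs.2 i hi A hA x hx y hy).trans_le (min_le_left _ _)⟩,
      fun Us hUs => ⟨hUs.1, fun i hi A hA x hx y hy =>
        (hUs.2 i hi A hA x hx y hy).trans_le (min_le_right _ _)⟩⟩) ⟨1, Set.mem_Ioi.2 one_pos⟩
  have : 𝓕.NeBot := h_basis.neBot_iff.2 fun hδ => exists_QAdmissible_dist_lt X π r hzd hδ
  have ha₀ : ∀ i < r - 1, 0 ≤ a i := fun i hi => (ha i hi).1
  have hr₁ : r - 1 < r := by lia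
  rcases isEmpty_or_nonempty (X 0).carrier with h | h
  · have := isEmpty_carrier π (r - 1)
    have hU : ∀ Us, pressU X π r a f Fn Us = 0 := fun Us => by
      simp [pressU, wPU_of_isEmpty]
    have hP : ∀ ε, pressEps X π r a f Fn ε = 0 := fun ε => by
      simp [pressEps, Set.eq_empty_of_isEmpty, wP_empty]
    simp only [hU] at hL
    rw [tendsto_nhds_unique hL tendsto_const_nhds, press]
    refine le_antisymm (iSup₂_le fun ε _ => (hP ε).le) ?_
    exact (hP 1).ge.trans (le_iSup₂ (f := fun (ε : ℝ) (_ : 0 < ε) => pressEps X π r a f Fn ε)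
      1 one_pos)
  have hne := nonempty_carrier π
  have hpos : ∀ (ε : ℝ), 0 < ε → ∀ F : Finset G, 0 < wP X π a f F ε (r - 1) Set.univ := by
    intro ε hε F
    obtain ⟨m, hm, hmP⟩ := exists_pos_le_wP (π := π) (F := F) hε hf ha₀ (r - 1) hr₁
    exact hm.trans_le (hmP _ Set.univ_nonempty)
  apply le_antisymm
  · refine iSup₂_le fun ε hε => ge_of_tendsto hL ?_
    refine h_basis.eventually_iff.2 ⟨ε, hε, fun Us hUs => ?_⟩
    exact limsup_log_div_card_mono Fn (fun n => hpos ε hε _)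
      fun n => wP_le_wPU hε hf ha₀ hUs.1.1 hUs.2 _ hr₁ _
  · refine le_of_tendsto hL (h_basis.eventually_iff.2 ⟨1, one_pos, fun Us hUs => ?_⟩)
    have hLeb : ∀ i < r, ∃ ε > 0, ∀ A : Set (X i).carrier,
        (∀ x ∈ A, ∀ y ∈ A, dist x y < ε) → ∃ B ∈ Us i, A ⊆ B := fun i hi =>
      (hUs.1.1 i hi).exists_lebesgue_number
    choose! e he heU using hLeb
    obtain ⟨ε, hε, hεe⟩ : ∃ ε > 0, ∀ i < r, ε ≤ e i := by
      have hne' : (Finset.range r).Nonempty := ⟨0, Finset.mem_range.2 (by lia)⟩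
      exact ⟨(Finset.range r).inf' hne' e, (Finset.lt_inf'_iff hne').2 fun i hi =>
        he i (Finset.mem_range.1 hi), fun i hi => Finset.inf'_le _ (Finset.mem_range.2 hi)⟩
    refine le_trans ?_ (le_iSup₂ (f := fun (ε : ℝ) (_ : 0 < ε) => pressEps X π r a f Fn ε) ε hε)
    exact limsup_log_div_card_mono Fn
      (fun n => (hpos 1 one_pos _).trans_le (wP_le_wPU one_pos hf ha₀ hUs.1.1 hUs.2 _ hr₁ _))
      fun n => wPU_le_wP hε ha₀ hUs.1.1 (fun i hi A hA => heU i hi A fun x hx y hy =>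
        (hA x hx y hy).trans_le (hεe i hi)) _ hr₁ _
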